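/- Theorem 4.2, first estimate (uniform-in-time error of dG(0) and dG(1) in the energy norm). Let q ∈ {0,1}. There is a constant C > 0, independent of T = t_N, N and the mesh, such that the error e = (e₁,e₂) := (U₁ − u₁, U₂ − u₂) satisfies ‖e₁‖_{1,I_N} + ‖e₂‖_{I_N} ≤ C ( k^{q+1} ‖u₁^{(q+1)}‖_{1,I_N} + k^{q+1} ‖u₂^{(q+1)}‖_{I_N} + Σ_{n=1}^N k_n^{q+2} ‖u₂^{(q+1)}‖_{1,I_n} + Σ_{n=1}^N k_n^{q+2} ‖u₁^{(q+1)}‖_{2,I_n} ), provided the right-hand side is finite. -/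

import Mathlib

noncomputable section

open scoped RealInnerProductSpace BigOperators
open MeasureTheory

/-- Squared fractional-order norm `‖v‖_α² = Σ_k λ_k^α (v,φ_k)²`. -/
def hsNormSq {H : Type*} [NormedAddCommGroup H] [InnerProductSpace ℝ H]
    (φ : ℕ → H) (lam : ℕ → ℝ) (α : ℝ) (v : H) : ℝ :=
  ∑' k, lam k ^ α * ⟪v, φ k⟫ ^ 2

/-- Fractional-order norm `‖v‖_α`. -/
def hsNorm {H : Type*} [NormedAddCommGroup H] [InnerProductSpace ℝ H]
    (φ : ℕ → H) (lam : ℕ → ℝ) (α : ℝ) (v : H) : ℝ :=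
  Real.sqrt (hsNormSq φ lam α v)

/-- Membership in the fractional-order space `Ḣ^α`. -/
def MemHs {H : Type*} [NormedAddCommGroup H] [InnerProductSpace ℝ H]
    (φ : ℕ → H) (lam : ℕ → ℝ) (α : ℝ) (v : H) : Prop :=
  Summable (fun k => lam k ^ α * ⟪v, φ k⟫ ^ 2)

/-- Weighted spectral pairing `Σ_k λ_k^l (u,φ_k)(v,φ_k)`.
`aPow φ lam 1 u v = a(u,v)`, `aPow φ lam (l+1) u v = a(u, A^l v)` and
`aPow φ lam l u v = (u, A^l v)`. -/
def aPow {H : Type*} [NormedAddCommGroup H] [InnerProductSpace ℝ H]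
    (φ : ℕ → H) (lam : ℕ → ℝ) (l : ℝ) (u v : H) : ℝ :=
  ∑' k, lam k ^ l * ⟪u, φ k⟫ * ⟪v, φ k⟫

/-- The energy bilinear form `a(u,v) = Σ_k λ_k (u,φ_k)(v,φ_k)`. -/
def aForm {H : Type*} [NormedAddCommGroup H] [InnerProductSpace ℝ H]
    (φ : ℕ → H) (lam : ℕ → ℝ) (u v : H) : ℝ :=
  aPow φ lam 1 u v

/-- The operator `A`, determined by `A φ_k = λ_k φ_k`. -/
def Aop {H : Type*} [NormedAddCommGroup H] [InnerProductSpace ℝ H]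
    (φ : ℕ → H) (lam : ℕ → ℝ) (v : H) : H :=
  ∑' k, (lam k * ⟪v, φ k⟫) • φ k

/-- Value at time `s` of the polynomial of degree ≤ q (with coefficients `c n ·`)
attached to the `n`-th time subinterval. -/
def pval {H : Type*} [NormedAddCommGroup H] [InnerProductSpace ℝ H]
    (q : ℕ) (c : ℕ → ℕ → H) (n : ℕ) (s : ℝ) : H :=
  ∑ j ∈ Finset.range (q + 1), s ^ j • c n j

/-- Time derivative of `pval`. -/
def pderiv {H : Type*} [NormedAddCommGroup H] [InnerProductSpace ℝ H]
    (q : ℕ) (c : ℕ → ℕ → H) (n : ℕ) (s : ℝ) : H :=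
  ∑ j ∈ Finset.range (q + 1), ((j : ℝ) * s ^ (j - 1)) • c n j

/-- The dG bilinear form `B((u₁,u₂),(v₁,v₂))`, where the piecewise polynomials
`u₁, u₂, v₁, v₂` are described by their coefficient families `c1, c2, d1, d2`
(on the mesh `0 = tt 0 < tt 1 < ⋯ < tt N`). -/
def Bform {H : Type*} [NormedAddCommGroup H] [InnerProductSpace ℝ H]
    (φ : ℕ → H) (lam : ℕ → ℝ) (tt : ℕ → ℝ) (N q : ℕ)
    (c1 c2 d1 d2 : ℕ → ℕ → H) : ℝ :=
  (∑ n ∈ Finset.Icc 1 N, ∫ s in tt (n-1)..tt n,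
      (aForm φ lam (pderiv q c1 n s) (pval q d1 n s)
        - aForm φ lam (pval q c2 n s) (pval q d1 n s)
        + ⟪pderiv q c2 n s, pval q d2 n s⟫
        + aForm φ lam (pval q c1 n s) (pval q d2 n s)))
  + (∑ n ∈ Finset.Icc 1 (N-1),
      (aForm φ lam (pval q c1 (n+1) (tt n) - pval q c1 n (tt n)) (pval q d1 (n+1) (tt n))
        + ⟪pval q c2 (n+1) (tt n) - pval q c2 n (tt n), pval q d2 (n+1) (tt n)⟫))
  + aForm φ lam (pval q c1 1 (tt 0)) (pval q d1 1 (tt 0))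
  + ⟪pval q c2 1 (tt 0), pval q d2 1 (tt 0)⟫

/-- Supremum of `g` over the open interval `(a,b)`. -/
def supIoo (g : ℝ → ℝ) (a b : ℝ) : ℝ :=
  sSup (g '' Set.Ioo a b)

/-- Squared discrete fractional norm `‖v‖_{h,s}² = ‖A_h^{s/2} v‖²`, expressed through
an orthonormal eigenbasis `e` of `A_h` on `S_h` with eigenvalues `μ`. -/
def hNormSqh {H : Type*} [NormedAddCommGroup H] [InnerProductSpace ℝ H]
    {m : ℕ} (e : Fin m → H) (μ : Fin m → ℝ) (s : ℝ) (v : H) : ℝ :=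
  ∑ i, μ i ^ s * ⟪v, e i⟫ ^ 2

/-- Discrete fractional norm `‖v‖_{h,s}`. -/
def hNormh {H : Type*} [NormedAddCommGroup H] [InnerProductSpace ℝ H]
    {m : ℕ} (e : Fin m → H) (μ : Fin m → ℝ) (s : ℝ) (v : H) : ℝ :=
  Real.sqrt (hNormSqh e μ s v)

/-- Discrete weighted pairing: `aPowh e μ (l+1) u v = a(u, A_h^l v)` and
`aPowh e μ l u v = (u, A_h^l v)` for `u, v ∈ S_h`. -/
def aPowh {H : Type*} [NormedAddCommGroup H] [InnerProductSpace ℝ H]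
    {m : ℕ} (e : Fin m → H) (μ : Fin m → ℝ) (l : ℝ) (u v : H) : ℝ :=
  ∑ i, μ i ^ l * ⟪u, e i⟫ * ⟪v, e i⟫

theorem ContinuousLinearMap.comp_intervalIntegrable {E F : Type*} [NormedAddCommGroup E]
    [NormedSpace ℝ E] [NormedAddCommGroup F] [NormedSpace ℝ F] (L : E →L[ℝ] F) {f : ℝ → E}
    {a b : ℝ} (hf : IntervalIntegrable f volume a b) :
    IntervalIntegrable (fun s => L (f s)) volume a b :=
  ⟨L.integrable_comp hf.1, L.integrable_comp hf.2⟩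

/-- Energy identity on one time interval for the difference `θ = P - R` of the discrete solution
`P s = p0 + s • p1` and the interpolant `R s = r0 + s • r1` of the exact solution `z`. -/
theorem energy_identity_step {X : Type*} [NormedAddCommGroup X] [InnerProductSpace ℝ X]
    [CompleteSpace X] (L : X →L[ℝ] X) (hL : ∀ x, ⟪L x, x⟫ = 0) {a b : ℝ} (hab : a ≤ b)
    {z g : ℝ → X} (hz : ContinuousOn z (Set.Icc a b))
    (hz' : ∀ s ∈ Set.Ioo a b, HasDerivAt z (L (z s) + g s) s)
    (hg : IntervalIntegrable g volume a b) (p0 p1 r0 r1 Zm : X)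
    (hmom0 : (∫ s in a..b, (p1 - L (p0 + s • p1) - g s)) + (p0 + a • p1 - Zm) = 0)
    (hmom1 : (p1 = 0 ∧ r1 = 0) ∨
      ((∫ s in a..b, s • (p1 - L (p0 + s • p1) - g s)) + a • (p0 + a • p1 - Zm) = 0 ∧
        ∫ s in a..b, (r0 + s • r1 - z s) = 0))
    (hb : r0 + b • r1 = z b) :
    ‖(p0 - r0) + b • (p1 - r1)‖ ^ 2 + ‖(p0 - r0) + a • (p1 - r1) - (Zm - z a)‖ ^ 2
      = ‖Zm - z a‖ ^ 2
        + 2 * ∫ s in a..b, ⟪L (r0 + s • r1 - z s), (p0 - r0) + s • (p1 - r1)⟫ := by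
  set v0 := p0 - r0 with hv0
  set v1 := p1 - r1 with hv1
  set F : ℝ → X := fun s => p1 - L (p0 + s • p1) - g s with hF
  set η : ℝ → X := fun s => r0 + s • r1 - z s with hη
  set J := p0 + a • p1 - Zm with hJ
  have hηc : ContinuousOn η (Set.Icc a b) := by
    apply ContinuousOn.sub _ hz
    fun_prop
  have hFi : IntervalIntegrable F volume a b := by
    apply IntervalIntegrable.sub _ hg
    apply Continuous.intervalIntegrable
    fun_prop
  have hsFi : IntervalIntegrable (fun s => s • F s) volume a b :=
    hFi.continuousOn_smul continuousOn_id
  have hi0 : IntervalIntegrable (fun s => ⟪v0, F s⟫) volume a b :=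
    (innerSL ℝ v0).comp_intervalIntegrable hFi
  have hi1 : IntervalIntegrable (fun s => ⟪v1, s • F s⟫) volume a b :=
    (innerSL ℝ v1).comp_intervalIntegrable hsFi
  have e0 : ∫ s in a..b, ⟪v0, F s⟫ = ⟪v0, ∫ s in a..b, F s⟫ :=
    (innerSL ℝ v0).intervalIntegral_comp_comm hFi
  have e1 : ∫ s in a..b, ⟪v1, s • F s⟫ = ⟪v1, ∫ s in a..b, s • F s⟫ :=
    (innerSL ℝ v1).intervalIntegral_comp_comm hsFi
  have hηi : IntervalIntegrable η volume a b := by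
    apply ContinuousOn.intervalIntegrable
    rwa [Set.uIcc_of_le hab]
  have e2 : ∫ s in a..b, ⟪v1, η s⟫ = ⟪v1, ∫ s in a..b, η s⟫ :=
    (innerSL ℝ v1).intervalIntegral_comp_comm hηi
  have hi2 : IntervalIntegrable (fun s => ⟪v1, η s⟫) volume a b :=
    (innerSL ℝ v1).comp_intervalIntegrable hηi
  have hi3 : IntervalIntegrable (fun s => ⟪L (η s), v0 + s • v1⟫) volume a b := by
    apply ContinuousOn.intervalIntegrable
    rw [Set.uIcc_of_le hab]
    exact (L.continuous.comp_continuousOn hηc).inner (by fun_prop)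
  have hm0 : ⟪v0, ∫ s in a..b, F s⟫ = - ⟪v0, J⟫ := by
    rw [eq_neg_of_add_eq_zero_left hmom0, inner_neg_right]
  have hm1 : ⟪v1, ∫ s in a..b, s • F s⟫ = - ⟪v1, a • J⟫ := by
    rcases hmom1 with ⟨h1, h2⟩ | ⟨h1, -⟩
    · simp [hv1, h1, h2]
    · rw [eq_neg_of_add_eq_zero_left h1, inner_neg_right]
  have hm2 : ⟪v1, ∫ s in a..b, η s⟫ = 0 := by
    rcases hmom1 with ⟨h1, h2⟩ | ⟨-, h1⟩
    · simp [hv1, h1, h2]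
    · rw [h1, inner_zero_right]
  have hder : ∀ s ∈ Set.Ioo a b,
      HasDerivAt (fun s => 1 / 2 * ⟪v0 + s • v1, v0 + s • v1⟫ + ⟪η s, v0 + s • v1⟫)
        (⟪v0, F s⟫ + ⟪v1, s • F s⟫ + ⟪v1, η s⟫ + ⟪L (η s), v0 + s • v1⟫) s := by
    intro s hs
    have hθ : HasDerivAt (fun s : ℝ => v0 + s • v1) v1 s := by
      simpa using ((hasDerivAt_id s).smul_const v1).const_add v0
    have hη' : HasDerivAt η (r1 - (L (z s) + g s)) s := by
      have : HasDerivAt (fun s : ℝ => r0 + s • r1) r1 s := by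
        simpa using ((hasDerivAt_id s).smul_const r1).const_add r0
      exact this.sub (hz' s hs)
    refine (((hθ.inner ℝ hθ).const_mul (1 / 2 : ℝ)).add (hη'.inner ℝ hθ)).congr_deriv ?_
    have hFs : F s = v1 + (r1 - (L (z s) + g s)) - L (v0 + s • v1) - L (η s) := by
      have : p0 + s • p1 = (v0 + s • v1) + η s + z s := by
        simp only [hv0, hv1, hη]; module
      simp only [hF]
      rw [this, map_add, map_add]
      simp only [hv1]
      abel
    have h1 : ⟪v0, F s⟫ + ⟪v1, s • F s⟫ = ⟪F s, v0 + s • v1⟫ := by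
      rw [inner_smul_right, inner_add_right, inner_smul_right, real_inner_comm v0,
        real_inner_comm v1]
    rw [h1, hFs]
    have h2 := hL (v0 + s • v1)
    rw [real_inner_comm v1 (η s), real_inner_comm v1 (v0 + s • v1)]
    generalize v0 + s • v1 = θ at h2 ⊢
    simp only [inner_add_left, inner_sub_left]
    linarith
  have hcont : ContinuousOn
      (fun s => 1 / 2 * ⟪v0 + s • v1, v0 + s • v1⟫ + ⟪η s, v0 + s • v1⟫) (Set.Icc a b) := by
    apply ContinuousOn.add
    · fun_prop
    · exact hηc.inner (by fun_prop)
  have key := intervalIntegral.integral_eq_sub_of_hasDerivAt_of_le hab hcont hder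
    (((hi0.add hi1).add hi2).add hi3)
  rw [intervalIntegral.integral_add ((hi0.add hi1).add hi2) hi3,
    intervalIntegral.integral_add (hi0.add hi1) hi2, intervalIntegral.integral_add hi0 hi1,
    e0, e1, e2, hm0, hm1, hm2] at key
  have hηb : η b = 0 := by simp [hη, hb]
  have hJ' : J = (v0 + a • v1) + η a - (Zm - z a) := by
    simp only [hJ, hv0, hv1, hη]; module
  rw [hηb, inner_zero_left] at key
  have h3 : - ⟪v0, J⟫ + - ⟪v1, a • J⟫ = - ⟪J, v0 + a • v1⟫ := by
    rw [inner_smul_right, inner_add_right, inner_smul_right, real_inner_comm v0,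
      real_inner_comm v1]
    ring
  rw [h3, hJ'] at key
  rw [norm_sub_sq_real, ← real_inner_self_eq_norm_sq (v0 + b • v1),
    ← real_inner_self_eq_norm_sq (v0 + a • v1), real_inner_comm (Zm - z a)]
  rw [inner_sub_left, inner_add_left] at key
  linarith

/-- Mean value inequality on a closed interval, differentiability being required only inside. -/
theorem norm_sub_le_of_norm_hasDerivAt_Ioo_le {E : Type*} [NormedAddCommGroup E]
    [NormedSpace ℝ E] {f f' : ℝ → E} {a b M : ℝ} (hab : a < b)
    (hf : ContinuousOn f (Set.Icc a b)) (hf' : ∀ s ∈ Set.Ioo a b, HasDerivAt f (f' s) s)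
    (hM : ∀ s ∈ Set.Ioo a b, ‖f' s‖ ≤ M) {x y : ℝ} (hx : x ∈ Set.Icc a b)
    (hy : y ∈ Set.Icc a b) : ‖f y - f x‖ ≤ (b - a) * M := by
  have hM0 : 0 ≤ M := (norm_nonneg _).trans (hM ((a + b) / 2) ⟨by linarith, by linarith⟩)
  have h : LipschitzOnWith M.toNNReal f (Set.Ioo a b) := by
    refine (convex_Ioo a b).lipschitzOnWith_of_nnnorm_hasDerivWithin_le
      (fun s hs => (hf' s hs).hasDerivWithinAt) fun s hs => ?_
    rw [← NNReal.coe_le_coe, Real.coe_toNNReal _ hM0]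
    exact hM s hs
  have hcl : closure (Set.Ioo a b) = Set.Icc a b := closure_Ioo hab.ne
  rw [← lipschitzOnWith_closure_iff (by rwa [hcl]), hcl] at h
  have h1 := h.dist_le_mul y hy x hx
  rw [Real.coe_toNNReal _ hM0, dist_eq_norm, Real.dist_eq] at h1
  have h2 : |y - x| ≤ b - a := by
    rw [abs_le]; constructor <;> linarith [hx.1, hx.2, hy.1, hy.2]
  calc _ ≤ M * |y - x| := h1
    _ ≤ M * (b - a) := by gcongr
    _ = _ := mul_comm _ _

/-- Degree-one case of the interpolant matching the value at the right end point and the mean. -/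
theorem exists_affine_interpolant {X : Type*} [NormedAddCommGroup X] [NormedSpace ℝ X]
    [CompleteSpace X] {a b : ℝ} (hab : a < b) {z z' z'' : ℝ → X}
    (hz : ContinuousOn z (Set.Icc a b))
    (hz' : ∀ s ∈ Set.Ioo a b, HasDerivAt z (z' s) s)
    (hz'' : ∀ s ∈ Set.Ioo a b, HasDerivAt z' (z'' s) s) :
    ∃ r0 r1 : X, r0 + b • r1 = z b ∧ (∫ s in a..b, (r0 + s • r1 - z s)) = 0 ∧
      ∀ (D : X →L[ℝ] X) (M : ℝ), (∀ s ∈ Set.Ioo a b, ‖D (z'' s)‖ ≤ M) →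
        ∀ s ∈ Set.Icc a b, ‖D (r0 + s • r1 - z s)‖ ≤ 6 * (b - a) ^ 2 * M := by
  have hk : 0 < b - a := sub_pos.2 hab
  set c := (a + b) / 2 with hc
  have hcm : c ∈ Set.Ioo a b := ⟨by rw [hc]; linarith, by rw [hc]; linarith⟩
  set r : ℝ → X := fun s => z s - (z c + (s - c) • z' c) with hr
  have hrc : ContinuousOn r (Set.Icc a b) := hz.sub (by fun_prop)
  have hri : IntervalIntegrable r volume a b := by
    apply ContinuousOn.intervalIntegrable
    rwa [Set.uIcc_of_le hab.le]
  set σ : X := (2 / (b - a) ^ 2) • ((b - a) • r b - ∫ s in a..b, r s) with hσ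
  have hη : ∀ s, z b - b • (z' c + σ) + s • (z' c + σ) - z s = r b + (s - b) • σ - r s := by
    intro s
    simp only [hr]
    module
  refine ⟨z b - b • (z' c + σ), z' c + σ, by abel, ?_, ?_⟩
  · simp only [hη]
    have h1 : ∫ s in a..b, (s - b) = -((b - a) ^ 2 / 2) := by
      rw [intervalIntegral.integral_sub (by simp) (by simp)]
      simp
      ring
    rw [intervalIntegral.integral_sub _ hri, intervalIntegral.integral_add,
      intervalIntegral.integral_smul_const, h1, intervalIntegral.integral_const, hσ, smul_smul]
    · have : -((b - a) ^ 2 / 2) * (2 / (b - a) ^ 2) = -1 := by field_simp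
      rw [this]
      module
    · simp
    · apply Continuous.intervalIntegrable; fun_prop
    · apply Continuous.intervalIntegrable; fun_prop
  · intro D M hM
    have hM0 : 0 ≤ M := (norm_nonneg _).trans (hM c hcm)
    have hz1 : ∀ s ∈ Set.Ioo a b, ‖D (z' s) - D (z' c)‖ ≤ (b - a) * M := by
      intro s hs
      have h1 := (convex_Ioo a b).norm_image_sub_le_of_norm_hasDerivWithin_le
        (f := fun s => D (z' s)) (f' := fun s => D (z'' s))
        (fun t ht => (D.hasFDerivAt.comp_hasDerivAt t (hz'' t ht)).hasDerivWithinAt) hM hcm hs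
      have h2 : ‖s - c‖ ≤ b - a := by
        rw [Real.norm_eq_abs, abs_le]
        constructor <;> linarith [hs.1, hs.2, hcm.1, hcm.2]
      calc _ ≤ M * ‖s - c‖ := h1
        _ ≤ M * (b - a) := by gcongr
        _ = _ := mul_comm _ _
    have hDr : ∀ s ∈ Set.Icc a b, ‖D (r s)‖ ≤ (b - a) ^ 2 * M := by
      intro s hs
      have h1 := norm_sub_le_of_norm_hasDerivAt_Ioo_le (f := fun s => D (r s))
        (f' := fun s => D (z' s) - D (z' c)) hab (D.continuous.comp_continuousOn hrc)
        (fun t ht => by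
          have h3 : HasDerivAt r (z' t - z' c) t := by
            have h4 : HasDerivAt (fun s : ℝ => z c + (s - c) • z' c) (z' c) t := by
              simpa using (((hasDerivAt_id t).sub_const c).smul_const (z' c)).const_add (z c)
            exact (hz' t ht).sub h4
          have := D.hasFDerivAt.comp_hasDerivAt t h3
          rwa [map_sub] at this)
        hz1 (Set.Ioo_subset_Icc_self hcm) hs
      have h2 : r c = 0 := by simp [hr]
      simp only [h2, map_zero, sub_zero] at h1
      linarith
    set R := (b - a) ^ 2 * M with hR
    have hR0 : 0 ≤ R := by positivity
    have hint : ‖D (∫ s in a..b, r s)‖ ≤ (b - a) * R := by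
      rw [← D.intervalIntegral_comp_comm hri, mul_comm, ← abs_of_pos hk]
      apply intervalIntegral.norm_integral_le_of_norm_le_const
      intro s hs
      rw [Set.uIoc_of_le hab.le] at hs
      exact hDr s (Set.Ioc_subset_Icc_self hs)
    have hrb := hDr b (Set.right_mem_Icc.2 hab.le)
    have hDσ : ‖D σ‖ ≤ 4 * R / (b - a) := by
      rw [hσ, map_smul, norm_smul, map_sub, map_smul]
      have h5 : ‖(b - a) • D (r b) - D (∫ s in a..b, r s)‖ ≤ 2 * ((b - a) * R) := by
        refine (norm_sub_le _ _).trans ?_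
        rw [norm_smul, Real.norm_of_nonneg hk.le]
        nlinarith
      rw [Real.norm_of_nonneg (by positivity)]
      calc _ ≤ 2 / (b - a) ^ 2 * (2 * ((b - a) * R)) := by gcongr
        _ = _ := by field_simp; ring
    intro s hs
    rw [hη, map_sub, map_add, map_smul]
    have h6 : ‖(s - b) • D σ‖ ≤ 4 * R := by
      rw [norm_smul]
      have h7 : ‖s - b‖ ≤ b - a := by
        rw [Real.norm_eq_abs, abs_le]
        constructor <;> linarith [hs.1, hs.2]
      calc _ ≤ (b - a) * (4 * R / (b - a)) := by gcongr
        _ = _ := by field_simp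
    calc _ ≤ ‖D (r b)‖ + ‖(s - b) • D σ‖ + ‖D (r s)‖ :=
          (norm_sub_le _ _).trans (by gcongr; exact norm_add_le _ _)
      _ ≤ R + 4 * R + R := by gcongr; exact hDr s hs
      _ = _ := by rw [hR]; ring

/-- The interpolant of degree `q ≤ 1` matching the value at the right end point and, for `q = 1`,
the mean, with its error measured through an arbitrary operator `D`. -/
theorem exists_interpolant {X : Type*} [NormedAddCommGroup X] [NormedSpace ℝ X]
    [CompleteSpace X] {q : ℕ} (hq : q = 0 ∨ q = 1) {a b : ℝ} (hab : a < b) {zd : ℕ → ℝ → X}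
    (hz : ContinuousOn (zd 0) (Set.Icc a b))
    (hzd : ∀ m < q + 1, ∀ s ∈ Set.Ioo a b, HasDerivAt (zd m) (zd (m + 1) s) s) :
    ∃ r0 r1 : X, r0 + b • r1 = zd 0 b ∧ (q = 0 → r1 = 0) ∧
      (q = 1 → (∫ s in a..b, (r0 + s • r1 - zd 0 s)) = 0) ∧
      ∀ (D : X →L[ℝ] X) (M : ℝ), (∀ s ∈ Set.Ioo a b, ‖D (zd (q + 1) s)‖ ≤ M) →
        ∀ s ∈ Set.Icc a b, ‖D (r0 + s • r1 - zd 0 s)‖ ≤ 6 * (b - a) ^ (q + 1) * M := by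
  have hk : 0 < b - a := sub_pos.2 hab
  rcases hq with rfl | rfl
  · refine ⟨zd 0 b, 0, by simp, fun _ => rfl, by simp, fun D M hM s hs => ?_⟩
    have hM0 : 0 ≤ M := (norm_nonneg _).trans (hM ((a + b) / 2) ⟨by linarith, by linarith⟩)
    have h := norm_sub_le_of_norm_hasDerivAt_Ioo_le (f := fun s => D (zd 0 s)) hab
      (D.continuous.comp_continuousOn hz)
      (fun t ht => D.hasFDerivAt.comp_hasDerivAt t (hzd 0 (by norm_num) t ht)) hM hs
      (Set.right_mem_Icc.2 hab.le)
    rw [smul_zero, add_zero, map_sub]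
    refine h.trans ?_
    have := mul_nonneg hk.le hM0
    rw [zero_add, pow_one]
    linarith
  · obtain ⟨r0, r1, h1, h2, h3⟩ := exists_affine_interpolant hab hz
      (hzd 0 (by norm_num)) (hzd 1 (by norm_num))
    exact ⟨r0, r1, h1, by simp, fun _ => h2, h3⟩

/-- Discrete stability: if every step of a scheme starting from `B 0 = 0` dissipates the jumps
`A n - B n` up to a term linear in the size `M` of the solution, then the solution is bounded by
the accumulated data. -/
theorem discrete_energy_stability {X : Type*} [NormedAddCommGroup X] {N : ℕ} {A B : ℕ → X}
    {δ : ℕ → ℝ} (hB : B 0 = 0) (hδ : ∀ n < N, 0 ≤ δ n)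
    (h : ∀ M : ℝ, ∀ n < N, ‖A n‖ ≤ M → ‖B (n + 1)‖ ≤ M →
      ‖B (n + 1)‖ ^ 2 + ‖A n - B n‖ ^ 2 ≤ ‖B n‖ ^ 2 + 2 * (δ n * M)) :
    ∀ n < N, ‖A n‖ ≤ 8 * ∑ i ∈ Finset.range N, δ i ∧
      ‖B (n + 1)‖ ≤ 8 * ∑ i ∈ Finset.range N, δ i := by
  rcases Nat.eq_zero_or_pos N with rfl | hN
  · simp
  obtain ⟨m, hm, hmax⟩ := Finset.exists_max_image (Finset.range N)
    (fun n => max ‖A n‖ ‖B (n + 1)‖) ⟨0, Finset.mem_range.2 hN⟩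
  set M := max ‖A m‖ ‖B (m + 1)‖ with hM
  set S := ∑ i ∈ Finset.range N, δ i with hS
  have hM0 : 0 ≤ M := (norm_nonneg _).trans (le_max_left _ _)
  have hA : ∀ n < N, ‖A n‖ ≤ M := fun n hn =>
    (le_max_left _ _).trans (hmax n (Finset.mem_range.2 hn))
  have hB' : ∀ n < N, ‖B (n + 1)‖ ≤ M := fun n hn =>
    (le_max_right _ _).trans (hmax n (Finset.mem_range.2 hn))
  have hsum : ∀ n ≤ N, ‖B n‖ ^ 2 ≤ 2 * ((∑ i ∈ Finset.range n, δ i) * M) := by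
    intro n
    induction n with
    | zero => simp [hB]
    | succ n ih =>
      intro hn
      have h1 := h M n hn (hA n hn) (hB' n hn)
      have h2 := ih (by omega)
      rw [Finset.sum_range_succ]
      nlinarith [sq_nonneg ‖A n - B n‖]
  have hle : ∀ n ≤ N, ∑ i ∈ Finset.range n, δ i ≤ S := fun n hn =>
    Finset.sum_le_sum_of_subset_of_nonneg (Finset.range_mono hn)
      fun i hi _ => hδ i (Finset.mem_range.1 hi)
  have hm' := Finset.mem_range.1 hm
  have hS0 : 0 ≤ S := Finset.sum_nonneg fun i hi => hδ i (Finset.mem_range.1 hi)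
  have hstep := mul_le_mul_of_nonneg_right (hle (m + 1) hm') hM0
  have hMsq : M ^ 2 ≤ 8 * S * M := by
    rcases max_choice ‖A m‖ ‖B (m + 1)‖ with hc | hc
    · have h1 := h M m hm' (hA m hm') (hB' m hm')
      have h2 := hsum m hm'.le
      have h3 : ‖A m‖ ≤ ‖A m - B m‖ + ‖B m‖ := norm_le_norm_sub_add _ _
      have h4 : ‖A m‖ ^ 2 ≤ 2 * (‖A m - B m‖ ^ 2 + ‖B m‖ ^ 2) := by
        nlinarith [sq_nonneg (‖A m - B m‖ - ‖B m‖), norm_nonneg (A m)]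
      have h5 : ‖A m - B m‖ ^ 2 ≤ ‖B m‖ ^ 2 + 2 * (δ m * M) := by
        nlinarith [sq_nonneg ‖B (m + 1)‖]
      rw [Finset.sum_range_succ] at hstep
      have h6 : M ^ 2 = ‖A m‖ ^ 2 := by rw [hM, hc]
      have h7 : 0 ≤ δ m * M := mul_nonneg (hδ m hm') hM0
      linarith
    · have h2 := hsum (m + 1) hm'
      have h6 : M ^ 2 = ‖B (m + 1)‖ ^ 2 := by rw [hM, hc]
      linarith [mul_nonneg hS0 hM0]
  have hfin : M ≤ 8 * S := by
    rcases hM0.eq_or_lt with h0 | h0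
    · rw [← h0]; positivity
    · nlinarith
  exact fun n hn => ⟨(hA n hn).trans hfin, (hB' n hn).trans hfin⟩

/-- Error of the dG(q) method, `q ≤ 1`, for `z' = L z + g` with a skew operator `L`. On the
`n`-th interval `(tt n, tt (n + 1))` the discrete solution is `P0 n + s • P1 n`, and `Zm n` is its
limit from the left at `tt n`. -/
theorem dG_error_of_skew {X : Type*} [NormedAddCommGroup X] [InnerProductSpace ℝ X]
    [CompleteSpace X] (L : X →L[ℝ] X) (hL : ∀ x, ⟪L x, x⟫ = 0) {q : ℕ} (hq : q = 0 ∨ q = 1)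
    {N : ℕ} {tt : ℕ → ℝ} (htt : ∀ n < N, tt n < tt (n + 1))
    {zd : ℕ → ℝ → X} {g : ℝ → X} (hz : ContinuousOn (zd 0) (Set.Icc (tt 0) (tt N)))
    (hzd : ∀ m < q + 1, ∀ s ∈ Set.Ioo (tt 0) (tt N), HasDerivAt (zd m) (zd (m + 1) s) s)
    (hode : ∀ s ∈ Set.Ioo (tt 0) (tt N), HasDerivAt (zd 0) (L (zd 0 s) + g s) s)
    (hg : IntervalIntegrable g volume (tt 0) (tt N))
    {P0 P1 Zm : ℕ → X} (hP : q = 0 → ∀ n < N, P1 n = 0) (hZ0 : Zm 0 = zd 0 (tt 0))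
    (hZs : ∀ n < N, Zm (n + 1) = P0 n + tt (n + 1) • P1 n)
    (hmom : ∀ n < N, ∀ j ≤ q,
      (∫ s in tt n..tt (n + 1), s ^ j • (P1 n - L (P0 n + s • P1 n) - g s))
        + tt n ^ j • (P0 n + tt n • P1 n - Zm n) = 0)
    {κ M0 : ℝ} {M1 : ℕ → ℝ} (hκ : ∀ n < N, tt (n + 1) - tt n ≤ κ)
    (hM0 : ∀ s ∈ Set.Ioo (tt 0) (tt N), ‖zd (q + 1) s‖ ≤ M0)
    (hM1 : ∀ n < N, ∀ s ∈ Set.Ioo (tt n) (tt (n + 1)), ‖L (zd (q + 1) s)‖ ≤ M1 n) :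
    ∀ n < N, ∀ s ∈ Set.Icc (tt n) (tt (n + 1)), ‖P0 n + s • P1 n - zd 0 s‖ ≤
      48 * (∑ i ∈ Finset.range N, (tt (i + 1) - tt i) ^ (q + 2) * M1 i)
        + 6 * κ ^ (q + 1) * M0 := by
  have hmono : ∀ m n, m ≤ n → n ≤ N → tt m ≤ tt n := by
    intro m n hmn
    induction hmn with
    | refl => exact fun _ => le_rfl
    | step _ ih => exact fun h => (ih (by omega)).trans (htt _ (by omega)).le
  have hIcc : ∀ n < N, Set.Icc (tt n) (tt (n + 1)) ⊆ Set.Icc (tt 0) (tt N) := fun n hn =>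
    Set.Icc_subset_Icc (hmono 0 n (by omega) hn.le) (hmono (n + 1) N hn le_rfl)
  have hIoo : ∀ n < N, Set.Ioo (tt n) (tt (n + 1)) ⊆ Set.Ioo (tt 0) (tt N) := fun n hn =>
    Set.Ioo_subset_Ioo (hmono 0 n (by omega) hn.le) (hmono (n + 1) N hn le_rfl)
  have hint : ∀ n, ∃ r0 r1 : X, n < N → (r0 + tt (n + 1) • r1 = zd 0 (tt (n + 1)) ∧
      (q = 0 → r1 = 0) ∧ (q = 1 → (∫ s in tt n..tt (n + 1), (r0 + s • r1 - zd 0 s)) = 0) ∧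
      ∀ (D : X →L[ℝ] X) (M : ℝ), (∀ s ∈ Set.Ioo (tt n) (tt (n + 1)), ‖D (zd (q + 1) s)‖ ≤ M) →
        ∀ s ∈ Set.Icc (tt n) (tt (n + 1)),
          ‖D (r0 + s • r1 - zd 0 s)‖ ≤ 6 * (tt (n + 1) - tt n) ^ (q + 1) * M) := by
    intro n
    by_cases hn : n < N
    · obtain ⟨r0, r1, h⟩ := exists_interpolant hq (htt n hn) (hz.mono (hIcc n hn))
        (fun m hm s hs => hzd m hm s (hIoo n hn hs))
      exact ⟨r0, r1, fun _ => h⟩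
    · exact ⟨0, 0, fun h => absurd h hn⟩
  choose r0 r1 hr using hint
  have hM1' : ∀ n < N, 0 ≤ M1 n := fun n hn =>
    (norm_nonneg _).trans (hM1 n hn ((tt n + tt (n + 1)) / 2)
      ⟨by linarith [htt n hn], by linarith [htt n hn]⟩)
  have hconv : ∀ n < N, ∀ s ∈ Set.Icc (tt n) (tt (n + 1)), ∀ M : ℝ,
      ‖(P0 n - r0 n) + tt n • (P1 n - r1 n)‖ ≤ M →
      ‖(P0 n - r0 n) + tt (n + 1) • (P1 n - r1 n)‖ ≤ M →
      ‖(P0 n - r0 n) + s • (P1 n - r1 n)‖ ≤ M := by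
    intro n hn s hs M h1 h2
    have hk := sub_pos.2 (htt n hn)
    have hsum : (tt (n + 1) - s) / (tt (n + 1) - tt n) + (s - tt n) / (tt (n + 1) - tt n) = 1 := by
      field_simp
      ring
    have hcomb : (tt (n + 1) - s) / (tt (n + 1) - tt n) * tt n
        + (s - tt n) / (tt (n + 1) - tt n) * tt (n + 1) = s := by
      field_simp
      ring
    have hmem := (convex_closedBall (0 : X) M) (mem_closedBall_zero_iff.2 h1)
      (mem_closedBall_zero_iff.2 h2) (div_nonneg (sub_nonneg.2 hs.2) hk.le)
      (div_nonneg (sub_nonneg.2 hs.1) hk.le) hsum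
    rw [mem_closedBall_zero_iff, smul_add, smul_add, smul_smul, smul_smul, add_add_add_comm,
      ← add_smul, ← add_smul, hsum, hcomb, one_smul] at hmem
    exact hmem
  have hθ : ∀ n < N, Zm (n + 1) - zd 0 (tt (n + 1))
      = (P0 n - r0 n) + tt (n + 1) • (P1 n - r1 n) := by
    intro n hn
    rw [hZs n hn, ← (hr n hn).1]
    module
  have hstab := discrete_energy_stability (N := N)
    (A := fun n => (P0 n - r0 n) + tt n • (P1 n - r1 n)) (B := fun n => Zm n - zd 0 (tt n))
    (δ := fun n => 6 * ((tt (n + 1) - tt n) ^ (q + 2) * M1 n)) (by simp [hZ0])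
    (fun n hn => by
      have := sub_pos.2 (htt n hn)
      have := hM1' n hn
      positivity)
    (fun M n hn hA hB => by
      rw [hθ n hn] at hB ⊢
      obtain ⟨h1, h2, h3, h4⟩ := hr n hn
      have hle := (htt n hn).le
      have hk := sub_pos.2 (htt n hn)
      have hM : 0 ≤ M := (norm_nonneg _).trans hA
      have hsub : IntervalIntegrable g volume (tt n) (tt (n + 1)) := by
        refine hg.mono_set ?_
        rw [Set.uIcc_of_le hle, Set.uIcc_of_le (hmono 0 N (by omega) le_rfl)]
        exact hIcc n hn
      have hm0 := hmom n hn 0 (by omega)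
      simp only [pow_zero, one_smul] at hm0
      have hm1 : (P1 n = 0 ∧ r1 n = 0) ∨
          ((∫ s in tt n..tt (n + 1), s • (P1 n - L (P0 n + s • P1 n) - g s))
            + tt n • (P0 n + tt n • P1 n - Zm n) = 0 ∧
            ∫ s in tt n..tt (n + 1), (r0 n + s • r1 n - zd 0 s) = 0) := by
        rcases hq with h | h
        · exact Or.inl ⟨hP h n hn, h2 h⟩
        · have hm := hmom n hn 1 h.ge
          simp only [pow_one] at hm
          exact Or.inr ⟨hm, h3 h⟩
      rw [energy_identity_step L hL hle (hz.mono (hIcc n hn))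
        (fun s hs => hode s (hIoo n hn hs)) hsub (P0 n) (P1 n) (r0 n) (r1 n) (Zm n) hm0 hm1 h1]
      gcongr
      have hbd : ∀ s ∈ Set.uIoc (tt n) (tt (n + 1)),
          ‖⟪L (r0 n + s • r1 n - zd 0 s), (P0 n - r0 n) + s • (P1 n - r1 n)⟫‖ ≤
            6 * (tt (n + 1) - tt n) ^ (q + 1) * M1 n * M := by
        intro s hs
        rw [Set.uIoc_of_le hle] at hs
        have hs' := Set.Ioc_subset_Icc_self hs
        have h5 := h4 L (M1 n) (hM1 n hn) s hs'
        have h6 := hconv n hn s hs' M hA hB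
        exact (norm_inner_le_norm _ _).trans
          (mul_le_mul h5 h6 (norm_nonneg _) ((norm_nonneg _).trans h5))
      have h7 := intervalIntegral.norm_integral_le_of_norm_le_const hbd
      rw [abs_of_pos hk] at h7
      refine (le_abs_self _).trans (h7.trans (le_of_eq ?_))
      ring)
  intro n hn s hs
  obtain ⟨hA, hB⟩ := hstab n hn
  rw [hθ n hn] at hB
  have hk := sub_pos.2 (htt n hn)
  have h8 := hconv n hn s hs _ hA hB
  have h9 := (hr n hn).2.2.2 (ContinuousLinearMap.id ℝ X) M0
    (fun t ht => hM0 t (hIoo n hn ht)) s hs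
  have hM0' : 0 ≤ M0 := (norm_nonneg _).trans (hM0 ((tt n + tt (n + 1)) / 2)
      (hIoo n hn ⟨by linarith, by linarith⟩))
  have hsplit : P0 n + s • P1 n - zd 0 s
      = ((P0 n - r0 n) + s • (P1 n - r1 n)) + (r0 n + s • r1 n - zd 0 s) := by module
  rw [hsplit]
  refine (norm_add_le _ _).trans (add_le_add (h8.trans (le_of_eq ?_)) (h9.trans ?_))
  · rw [← Finset.mul_sum]
    ring
  · gcongr
    exact hκ n hn

theorem aForm_smul_basis {H : Type*} [NormedAddCommGroup H] [InnerProductSpace ℝ H]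
    {φ : ℕ → H} (hφ : Orthonormal ℝ φ) (lam : ℕ → ℝ) (u : H) (r : ℝ) (k : ℕ) :
    aForm φ lam u (r • φ k) = lam k * (r * ⟪u, φ k⟫) := by
  unfold aForm aPow
  rw [tsum_eq_single k]
  · rw [Real.rpow_one, inner_smul_left, real_inner_self_eq_norm_sq, hφ.1 k]
    simp
    ring
  · intro m hm
    rw [inner_smul_left, hφ.2 hm.symm]
    simp

theorem aForm_zero_right {H : Type*} [NormedAddCommGroup H] [InnerProductSpace ℝ H]
    (φ : ℕ → H) (lam : ℕ → ℝ) (u : H) : aForm φ lam u 0 = 0 := by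
  simp [aForm, aPow]

theorem memHs_smul_basis {H : Type*} [NormedAddCommGroup H] [InnerProductSpace ℝ H]
    {φ : ℕ → H} (hφ : Orthonormal ℝ φ) (lam : ℕ → ℝ) (α r : ℝ) (k : ℕ) :
    MemHs φ lam α (r • φ k) := by
  refine summable_of_ne_finset_zero (s := {k}) fun m hm => ?_
  rw [Finset.notMem_singleton] at hm
  rw [inner_smul_left, hφ.2 (Ne.symm hm)]
  simp

/-- Coefficients of the test function `s ↦ s ^ j • x` supported on the `n`-th interval. -/
def monomialTest {H : Type*} [NormedAddCommGroup H] (n j : ℕ) (x : H) : ℕ → ℕ → H :=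
  fun m i => if m = n ∧ i = j then x else 0

theorem pval_monomialTest_same {H : Type*} [NormedAddCommGroup H] [InnerProductSpace ℝ H]
    {q j : ℕ} (hj : j ≤ q) (n : ℕ) (x : H) (s : ℝ) :
    pval q (monomialTest n j x) n s = s ^ j • x := by
  unfold pval monomialTest
  rw [Finset.sum_eq_single j]
  · simp
  · intro b _ hb
    simp [hb]
  · intro h
    exact absurd (Finset.mem_range.2 (by omega)) h

theorem pval_monomialTest_of_ne {H : Type*} [NormedAddCommGroup H] [InnerProductSpace ℝ H]
    (q j : ℕ) {m n : ℕ} (hmn : m ≠ n) (x : H) (s : ℝ) :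
    pval q (monomialTest n j x) m s = 0 := by
  simp [pval, monomialTest, hmn]

/-- Limit from the left at the node `tt n` of the piecewise polynomial with coefficients `c`,
the value at the initial node being `x0`. -/
def leftLimit {H : Type*} [NormedAddCommGroup H] [InnerProductSpace ℝ H]
    (q : ℕ) (tt : ℕ → ℝ) (c : ℕ → ℕ → H) (x0 : H) : ℕ → H
  | 0 => x0
  | n + 1 => pval q c (n + 1) (tt (n + 1))

/-- The dG equations tested with `s ↦ s ^ j • (α • φ k, β • φ k)` on a single interval. -/
theorem dG_local_equation {H : Type*} [NormedAddCommGroup H] [InnerProductSpace ℝ H]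
    {φ : ℕ → H} {lam : ℕ → ℝ} (hφ : Orthonormal ℝ φ) {q N : ℕ} {tt : ℕ → ℝ} {f : ℝ → H}
    {u0 v0 : H} {c1 c2 : ℕ → ℕ → H}
    (hdG : ∀ d1 d2 : ℕ → ℕ → H, (∀ n j, MemHs φ lam 1 (d1 n j)) →
      (∀ n j, MemHs φ lam 1 (d2 n j)) →
      Bform φ lam tt N q c1 c2 d1 d2 =
        (∑ n ∈ Finset.Icc 1 N, ∫ s in tt (n-1)..tt n, ⟪f s, pval q d2 n s⟫)
          + aForm φ lam u0 (pval q d1 1 (tt 0)) + ⟪v0, pval q d2 1 (tt 0)⟫)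
    {n j : ℕ} (hn : n < N) (hj : j ≤ q) (k : ℕ) (α β : ℝ) :
    (∫ s in tt n..tt (n + 1),
        (lam k * (s ^ j * α * ⟪pderiv q c1 (n + 1) s, φ k⟫)
          - lam k * (s ^ j * α * ⟪pval q c2 (n + 1) s, φ k⟫)
          + s ^ j * β * ⟪pderiv q c2 (n + 1) s, φ k⟫
          + lam k * (s ^ j * β * ⟪pval q c1 (n + 1) s, φ k⟫)))
      + lam k * (tt n ^ j * α *
          ⟪pval q c1 (n + 1) (tt n) - leftLimit q tt c1 u0 n, φ k⟫)
      + tt n ^ j * β * ⟪pval q c2 (n + 1) (tt n) - leftLimit q tt c2 v0 n, φ k⟫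
      = ∫ s in tt n..tt (n + 1), s ^ j * β * ⟪f s, φ k⟫ := by
  have hmem : ∀ (r : ℝ) (m i : ℕ), MemHs φ lam 1 (monomialTest (n + 1) j (r • φ k) m i) := by
    intro r m i
    unfold monomialTest
    split_ifs
    · exact memHs_smul_basis hφ lam 1 r k
    · simpa using memHs_smul_basis hφ lam 1 0 k
  have h := hdG (monomialTest (n + 1) j (α • φ k)) (monomialTest (n + 1) j (β • φ k))
    (hmem α) (hmem β)
  unfold Bform at h
  have hmemN : n + 1 ∈ Finset.Icc 1 N := Finset.mem_Icc.2 ⟨by omega, hn⟩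
  rw [Finset.sum_eq_single_of_mem (n + 1) hmemN
      (fun m _ hm => by simp [pval_monomialTest_of_ne q j hm, aForm_zero_right]),
    Finset.sum_eq_single_of_mem (n + 1) hmemN
      (fun m _ hm => by simp [pval_monomialTest_of_ne q j hm])] at h
  simp only [pval_monomialTest_same hj, Nat.add_sub_cancel, smul_smul,
    aForm_smul_basis hφ, inner_smul_right] at h
  rcases n with _ | n
  · rw [Finset.sum_eq_zero (fun m hm => by
      have hm1 : m + 1 ≠ 0 + 1 := by have := (Finset.mem_Icc.1 hm).1; omega
      simp [pval_monomialTest_of_ne q j hm1, aForm_zero_right])] at h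
    simp only [zero_add, pval_monomialTest_same hj, smul_smul, aForm_smul_basis hφ,
      inner_smul_right] at h
    simp only [leftLimit, zero_add, inner_sub_left]
    linarith
  · have hmem' : n + 1 ∈ Finset.Icc 1 (N - 1) := Finset.mem_Icc.2 ⟨by omega, by omega⟩
    rw [Finset.sum_eq_single_of_mem (n + 1) hmem' (fun m _ hm => by
      have hm1 : m + 1 ≠ n + 1 + 1 := by omega
      simp [pval_monomialTest_of_ne q j hm1, aForm_zero_right])] at h
    have h1 : 1 ≠ n + 1 + 1 := by omega
    simp only [pval_monomialTest_same hj, pval_monomialTest_of_ne q j h1, smul_smul,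
      aForm_smul_basis hφ, inner_smul_right, aForm_zero_right, inner_zero_right] at h
    simp only [leftLimit]
    linarith

theorem pderiv_eq_const {H : Type*} [NormedAddCommGroup H] [InnerProductSpace ℝ H]
    {q : ℕ} (hq : q = 0 ∨ q = 1) (c : ℕ → ℕ → H) (n : ℕ) (s : ℝ) :
    pderiv q c n s = pderiv q c n 0 := by
  rcases hq with rfl | rfl <;> simp [pderiv, Finset.sum_range_succ]

theorem pval_eq_affine {H : Type*} [NormedAddCommGroup H] [InnerProductSpace ℝ H]
    {q : ℕ} (hq : q = 0 ∨ q = 1) (c : ℕ → ℕ → H) (n : ℕ) (s : ℝ) :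
    pval q c n s = c n 0 + s • pderiv q c n 0 := by
  rcases hq with rfl | rfl <;> simp [pval, pderiv, Finset.sum_range_succ]

theorem inner_Aop {H : Type*} [NormedAddCommGroup H] [InnerProductSpace ℝ H] [CompleteSpace H]
    {φ : ℕ → H} (hφ : Orthonormal ℝ φ) {lam : ℕ → ℝ} {v : H} (hv : MemHs φ lam 2 v) (k : ℕ) :
    ⟪φ k, Aop φ lam v⟫ = lam k * ⟪v, φ k⟫ := by
  have hs : Summable fun k => (lam k * ⟪v, φ k⟫) • φ k := by
    have h := (hφ.orthogonalFamily).summable_iff_norm_sq_summable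
      (fun k => lam k * ⟪v, φ k⟫)
    simp only [LinearIsometry.toSpanSingleton_apply] at h
    refine h.2 (hv.congr fun m => ?_)
    rw [Real.rpow_two, Real.norm_eq_abs, sq_abs, mul_pow]
  unfold Aop
  rw [← innerSL_apply_apply ℝ, (innerSL ℝ (φ k)).map_tsum hs, tsum_eq_single k]
  · simp [hφ.1 k]
  · intro m hm
    simp [hφ.2 hm.symm]

theorem norm_le_of_sum_inner_sq_le {H : Type*} [NormedAddCommGroup H] [InnerProductSpace ℝ H]
    [CompleteSpace H] {φ : ℕ → H} (hφ : Orthonormal ℝ φ)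
    (hφtotal : (Submodule.span ℝ (Set.range φ)).topologicalClosure = ⊤) {x : H} {R : ℝ}
    (hR : 0 ≤ R) (h : ∀ K, ∑ k ∈ Finset.range K, ⟪x, φ k⟫ ^ 2 ≤ R ^ 2) : ‖x‖ ≤ R := by
  refine le_of_sq_le_sq ?_ hR
  have hsum := (HilbertBasis.mk hφ hφtotal.ge).hasSum_inner_mul_inner x x
  rw [← real_inner_self_eq_norm_sq, ← hsum.tsum_eq]
  refine hsum.summable.tsum_le_of_sum_range_le fun K => ?_
  refine le_of_eq_of_le (Finset.sum_congr rfl fun k _ => ?_) (h K)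
  rw [HilbertBasis.coe_mk, real_inner_comm x, sq]

theorem hsNorm_one_le_of_sum_le {H : Type*} [NormedAddCommGroup H] [InnerProductSpace ℝ H]
    {φ : ℕ → H} {lam : ℕ → ℝ} (hlam : ∀ k, 0 < lam k) {x : H} {R : ℝ}
    (hR : 0 ≤ R) (h : ∀ K, ∑ k ∈ Finset.range K, lam k * ⟪x, φ k⟫ ^ 2 ≤ R ^ 2) :
    hsNorm φ lam 1 x ≤ R := by
  refine Real.sqrt_le_iff.2 ⟨hR, ?_⟩
  unfold hsNormSq
  simp only [Real.rpow_one]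
  exact Real.tsum_le_of_sum_range_le (fun k => mul_nonneg (hlam k).le (sq_nonneg _)) h

theorem MemHs.one_of_two {H : Type*} [NormedAddCommGroup H] [InnerProductSpace ℝ H]
    {φ : ℕ → H} {lam : ℕ → ℝ} (hlam : ∀ k, 0 < lam k) (hmono : Monotone lam) {v : H}
    (hv : MemHs φ lam 2 v) : MemHs φ lam 1 v := by
  refine Summable.of_nonneg_of_le (fun k => ?_) (fun k => ?_) (hv.mul_left (lam 0)⁻¹)
  · have := hlam k
    positivity
  · rw [Real.rpow_one, Real.rpow_two, ← mul_assoc]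
    gcongr
    rw [inv_mul_eq_div, le_div_iff₀ (hlam 0), sq]
    exact mul_le_mul_of_nonneg_left (hmono (Nat.zero_le k)) (hlam k).le

/-- Coordinates of `A^{1/2} u` in the first `K` modes, placed in the first component. -/
def energyModes {H : Type*} [NormedAddCommGroup H] [InnerProductSpace ℝ H]
    (φ : ℕ → H) (lam : ℕ → ℝ) (K : ℕ) : H →L[ℝ] EuclideanSpace ℝ (Fin K ⊕ Fin K) :=
  (EuclideanSpace.equiv (Fin K ⊕ Fin K) ℝ).symm.toContinuousLinearMap.comp
    (ContinuousLinearMap.pi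
      (Sum.elim (fun k : Fin K => √(lam k) • innerSL ℝ (φ k)) (fun _ => 0)))

/-- Coordinates of `v` in the first `K` modes, placed in the second component. -/
def velocityModes {H : Type*} [NormedAddCommGroup H] [InnerProductSpace ℝ H]
    (φ : ℕ → H) (K : ℕ) : H →L[ℝ] EuclideanSpace ℝ (Fin K ⊕ Fin K) :=
  (EuclideanSpace.equiv (Fin K ⊕ Fin K) ℝ).symm.toContinuousLinearMap.comp
    (ContinuousLinearMap.pi (Sum.elim (fun _ => 0) (fun k : Fin K => innerSL ℝ (φ k))))

/-- The wave generator `(x, y) ↦ (A^{1/2} y, -A^{1/2} x)` on the first `K` modes. -/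
def waveGenerator (lam : ℕ → ℝ) (K : ℕ) :
    EuclideanSpace ℝ (Fin K ⊕ Fin K) →L[ℝ] EuclideanSpace ℝ (Fin K ⊕ Fin K) :=
  (EuclideanSpace.equiv (Fin K ⊕ Fin K) ℝ).symm.toContinuousLinearMap.comp
    (ContinuousLinearMap.pi
      (Sum.elim (fun k : Fin K => √(lam k) • EuclideanSpace.proj (Sum.inr k))
        (fun k : Fin K => -√(lam k) • EuclideanSpace.proj (Sum.inl k))))

section Modes

variable {H : Type*} [NormedAddCommGroup H] [InnerProductSpace ℝ H]
  (φ : ℕ → H) (lam : ℕ → ℝ) {K : ℕ} (k : Fin K) (v : H)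

@[simp]
theorem energyModes_inl : energyModes φ lam K v (Sum.inl k) = √(lam k) * ⟪φ k, v⟫ := by
  simp [energyModes]

@[simp]
theorem energyModes_inr : energyModes φ lam K v (Sum.inr k) = 0 := by
  simp [energyModes]

@[simp]
theorem velocityModes_inl : velocityModes φ K v (Sum.inl k) = 0 := by
  simp [velocityModes]

@[simp]
theorem velocityModes_inr : velocityModes φ K v (Sum.inr k) = ⟪φ k, v⟫ := by
  simp [velocityModes]

@[simp]
theorem waveGenerator_inl (x : EuclideanSpace ℝ (Fin K ⊕ Fin K)) :
    waveGenerator lam K x (Sum.inl k) = √(lam k) * x (Sum.inr k) := by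
  simp [waveGenerator]

@[simp]
theorem waveGenerator_inr (x : EuclideanSpace ℝ (Fin K ⊕ Fin K)) :
    waveGenerator lam K x (Sum.inr k) = -(√(lam k) * x (Sum.inl k)) := by
  simp [waveGenerator]

end Modes

theorem inner_waveGenerator_self (lam : ℕ → ℝ) (K : ℕ) (x : EuclideanSpace ℝ (Fin K ⊕ Fin K)) :
    ⟪waveGenerator lam K x, x⟫ = 0 := by
  rw [PiLp.inner_apply, Fintype.sum_sum_type, ← Finset.sum_add_distrib]
  refine Finset.sum_eq_zero fun k _ => ?_
  simp only [waveGenerator_inl, waveGenerator_inr, RCLike.inner_apply, conj_trivial]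
  ring

theorem norm_le_hsNorm_of_sq_eq {H : Type*} [NormedAddCommGroup H] [InnerProductSpace ℝ H]
    {φ : ℕ → H} {lam : ℕ → ℝ} (hlam : ∀ k, 0 < lam k) {α : ℝ} {v : H} (hv : MemHs φ lam α v)
    {E : Type*} [NormedAddCommGroup E] {x : E} {K : ℕ}
    (hx : ‖x‖ ^ 2 = ∑ k : Fin K, lam k ^ α * ⟪v, φ k⟫ ^ 2) : ‖x‖ ≤ hsNorm φ lam α v := by
  refine Real.le_sqrt_of_sq_le ?_
  rw [hx, Fin.sum_univ_eq_sum_range (fun k => lam k ^ α * ⟪v, φ k⟫ ^ 2)]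
  exact hv.sum_le_tsum _ fun k _ =>
    mul_nonneg (Real.rpow_nonneg (hlam k).le _) (sq_nonneg _)

section ModeNorms

variable {H : Type*} [NormedAddCommGroup H] [InnerProductSpace ℝ H]
  {φ : ℕ → H} {lam : ℕ → ℝ} {v : H}

theorem norm_energyModes_le (hlam : ∀ k, 0 < lam k) (K : ℕ) (hv : MemHs φ lam 1 v) :
    ‖energyModes φ lam K v‖ ≤ hsNorm φ lam 1 v := by
  refine norm_le_hsNorm_of_sq_eq hlam hv (K := K) ?_
  rw [EuclideanSpace.real_norm_sq_eq, Fintype.sum_sum_type]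
  simp [mul_pow, Real.sq_sqrt (hlam _).le, real_inner_comm v]

theorem norm_waveGenerator_energyModes_le (hlam : ∀ k, 0 < lam k) (K : ℕ)
    (hv : MemHs φ lam 2 v) :
    ‖waveGenerator lam K (energyModes φ lam K v)‖ ≤ hsNorm φ lam 2 v := by
  refine norm_le_hsNorm_of_sq_eq hlam hv (K := K) ?_
  rw [EuclideanSpace.real_norm_sq_eq, Fintype.sum_sum_type]
  simp [mul_pow, Real.sq_sqrt (hlam _).le, real_inner_comm v, ← mul_assoc, ← sq]

theorem norm_waveGenerator_velocityModes_le (hlam : ∀ k, 0 < lam k) (K : ℕ)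
    (hv : MemHs φ lam 1 v) :
    ‖waveGenerator lam K (velocityModes φ K v)‖ ≤ hsNorm φ lam 1 v := by
  refine norm_le_hsNorm_of_sq_eq hlam hv (K := K) ?_
  rw [EuclideanSpace.real_norm_sq_eq, Fintype.sum_sum_type]
  simp [mul_pow, Real.sq_sqrt (hlam _).le, real_inner_comm v]

end ModeNorms

theorem norm_velocityModes_le {H : Type*} [NormedAddCommGroup H] [InnerProductSpace ℝ H]
    {φ : ℕ → H} (hφ : Orthonormal ℝ φ) (K : ℕ) (v : H) : ‖velocityModes φ K v‖ ≤ ‖v‖ := by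
  refine le_of_sq_le_sq ?_ (norm_nonneg v)
  rw [EuclideanSpace.real_norm_sq_eq, Fintype.sum_sum_type]
  simp only [velocityModes_inl, velocityModes_inr]
  have h := hφ.sum_inner_products_le v (s := Finset.range K)
  rw [Fin.sum_univ_eq_sum_range (fun k => ⟪φ k, v⟫ ^ 2)]
  simpa using h

/-- The dG equations of one interval, written for the first `K` modes. -/
theorem dG_modes_equation {H : Type*} [NormedAddCommGroup H] [InnerProductSpace ℝ H]
    {φ : ℕ → H} {lam : ℕ → ℝ} (hφ : Orthonormal ℝ φ) (hlam : ∀ k, 0 < lam k) {q N : ℕ}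
    (hq : q = 0 ∨ q = 1) {tt : ℕ → ℝ} {f : ℝ → H} {u0 v0 : H} {c1 c2 : ℕ → ℕ → H}
    (hdG : ∀ d1 d2 : ℕ → ℕ → H, (∀ n j, MemHs φ lam 1 (d1 n j)) →
      (∀ n j, MemHs φ lam 1 (d2 n j)) →
      Bform φ lam tt N q c1 c2 d1 d2 =
        (∑ n ∈ Finset.Icc 1 N, ∫ s in tt (n-1)..tt n, ⟪f s, pval q d2 n s⟫)
          + aForm φ lam u0 (pval q d1 1 (tt 0)) + ⟪v0, pval q d2 1 (tt 0)⟫)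
    {n j : ℕ} (hn : n < N) (hj : j ≤ q) (hf : IntervalIntegrable f volume (tt n) (tt (n + 1)))
    (K : ℕ) {J : H → H → EuclideanSpace ℝ (Fin K ⊕ Fin K)}
    (hJ : J = fun x y => energyModes φ lam K x + velocityModes φ K y) :
    (∫ s in tt n..tt (n + 1), s ^ j • (J (pderiv q c1 (n + 1) 0) (pderiv q c2 (n + 1) 0)
        - waveGenerator lam K (J (c1 (n + 1) 0) (c2 (n + 1) 0)
            + s • J (pderiv q c1 (n + 1) 0) (pderiv q c2 (n + 1) 0))
        - velocityModes φ K (f s)))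
      + tt n ^ j • (J (c1 (n + 1) 0) (c2 (n + 1) 0)
          + tt n • J (pderiv q c1 (n + 1) 0) (pderiv q c2 (n + 1) 0)
          - J (leftLimit q tt c1 u0 n) (leftLimit q tt c2 v0 n)) = 0 := by
  have hint : IntervalIntegrable
      (fun s => s ^ j • (J (pderiv q c1 (n + 1) 0) (pderiv q c2 (n + 1) 0)
        - waveGenerator lam K (J (c1 (n + 1) 0) (c2 (n + 1) 0)
            + s • J (pderiv q c1 (n + 1) 0) (pderiv q c2 (n + 1) 0))
        - velocityModes φ K (f s))) volume (tt n) (tt (n + 1)) := by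
    refine IntervalIntegrable.continuousOn_smul (IntervalIntegrable.sub ?_
      ((velocityModes φ K).comp_intervalIntegrable hf)) (by fun_prop)
    apply Continuous.intervalIntegrable
    fun_prop
  have hcoord : ∀ i, (∫ s in tt n..tt (n + 1),
      s ^ j • (J (pderiv q c1 (n + 1) 0) (pderiv q c2 (n + 1) 0)
        - waveGenerator lam K (J (c1 (n + 1) 0) (c2 (n + 1) 0)
            + s • J (pderiv q c1 (n + 1) 0) (pderiv q c2 (n + 1) 0))
        - velocityModes φ K (f s))) i = ∫ s in tt n..tt (n + 1),
      (s ^ j • (J (pderiv q c1 (n + 1) 0) (pderiv q c2 (n + 1) 0)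
        - waveGenerator lam K (J (c1 (n + 1) 0) (c2 (n + 1) 0)
            + s • J (pderiv q c1 (n + 1) 0) (pderiv q c2 (n + 1) 0))
        - velocityModes φ K (f s))) i := fun i =>
    ((EuclideanSpace.proj (𝕜 := ℝ) i).intervalIntegral_comp_comm hint).symm
  have hfk : ∀ k, IntervalIntegrable (fun s => s ^ j * ⟪φ k, f s⟫) volume
      (tt n) (tt (n + 1)) := fun k =>
    ((innerSL ℝ (φ k)).comp_intervalIntegrable hf).continuousOn_mul (by fun_prop)
  ext i
  rw [PiLp.add_apply, hcoord]
  rcases i with k | k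
  · have h := dG_local_equation hφ hdG hn hj k (√(lam k))⁻¹ 0
    have hs2 : ∀ x y : ℝ, lam k * (x * (√(lam k))⁻¹ * y) = √(lam k) * (x * y) := fun x y => by
      rw [← mul_assoc, mul_left_comm, ← div_eq_mul_inv, Real.div_sqrt]
      ring
    simp only [pderiv_eq_const hq _ _ (_ : ℝ), pval_eq_affine hq, hs2, mul_zero, zero_mul,
      add_zero, intervalIntegral.integral_zero] at h
    rw [PiLp.zero_apply]
    refine Eq.trans ?_ h
    congr 1
    · refine intervalIntegral.integral_congr fun s _ => ?_
      simp only [hJ, PiLp.smul_apply, PiLp.sub_apply, PiLp.add_apply, energyModes_inl,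
        velocityModes_inl, energyModes_inr, velocityModes_inr, waveGenerator_inl, smul_eq_mul,
        inner_add_right, inner_smul_right, real_inner_comm (φ k)]
      ring
    · simp only [hJ, PiLp.smul_apply, PiLp.sub_apply, PiLp.add_apply, energyModes_inl,
        velocityModes_inl, smul_eq_mul, inner_sub_right,
        inner_add_right, inner_smul_right, real_inner_comm (φ k)]
      ring
  · have h := dG_local_equation hφ hdG hn hj k 0 1
    have hsq : √(lam k) * √(lam k) = lam k := Real.mul_self_sqrt (hlam k).le
    simp only [pderiv_eq_const hq _ _ (_ : ℝ), pval_eq_affine hq, mul_zero, zero_mul, mul_one,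
      sub_zero, zero_add, add_zero] at h
    rw [PiLp.zero_apply]
    refine Eq.trans ?_ ((add_sub_right_comm _ _ _).symm.trans (sub_eq_zero.2 h))
    rw [← intervalIntegral.integral_sub]
    · congr 1
      · refine intervalIntegral.integral_congr fun s _ => ?_
        simp only [hJ, PiLp.smul_apply, PiLp.sub_apply, PiLp.add_apply, energyModes_inl,
          velocityModes_inl, energyModes_inr, velocityModes_inr, waveGenerator_inr, smul_eq_mul,
          inner_add_right, inner_smul_right, real_inner_comm (φ k)]
        linear_combination s ^ j * (⟪φ k, c1 (n + 1) 0⟫ + s * ⟪φ k, pderiv q c1 (n + 1) 0⟫) * hsq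
      · simp only [hJ, PiLp.smul_apply, PiLp.sub_apply, PiLp.add_apply, energyModes_inr,
          velocityModes_inr, smul_eq_mul, inner_sub_right,
          inner_add_right, inner_smul_right, real_inner_comm (φ k)]
        ring
    · apply Continuous.intervalIntegrable
      fun_prop
    · simpa only [real_inner_comm (φ k)] using hfk k

theorem monotoneOn_mesh {tt : ℕ → ℝ} {N : ℕ} (htt : ∀ n < N, tt n < tt (n + 1)) :
    MonotoneOn tt (Set.Iic N) :=
  monotoneOn_of_le_succ Set.ordConnected_Iic fun a _ _ ha =>
    (htt a (Order.succ_le_iff.1 ha)).le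

/-- The first `K` modes of the wave equation form a linear system with generator
`waveGenerator`. -/
theorem modes_ode {H : Type*} [NormedAddCommGroup H] [InnerProductSpace ℝ H] [CompleteSpace H]
    {φ : ℕ → H} {lam : ℕ → ℝ} (hφ : Orthonormal ℝ φ) (hlam : ∀ k, 0 < lam k) (K : ℕ)
    {x : H} (y z : H) (hx : MemHs φ lam 2 x) :
    energyModes φ lam K y + velocityModes φ K (z - Aop φ lam x) =
      waveGenerator lam K (energyModes φ lam K x + velocityModes φ K y) + velocityModes φ K z := by
  ext i
  rcases i with k | k
  · simp only [PiLp.add_apply, energyModes_inl, velocityModes_inl, energyModes_inr,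
      velocityModes_inr, waveGenerator_inl]
    ring
  · have hsq : √(lam k) * √(lam k) = lam k := Real.mul_self_sqrt (hlam k).le
    simp only [PiLp.add_apply, energyModes_inl, velocityModes_inl, energyModes_inr,
      velocityModes_inr, waveGenerator_inr, inner_sub_right, inner_Aop hφ hx,
      real_inner_comm (φ k)]
    linear_combination ⟪φ k, x⟫ * hsq

/-- Error bound for the first `K` modes of the dG approximation. -/
theorem dG_modes_error {H : Type*} [NormedAddCommGroup H] [InnerProductSpace ℝ H]
    [CompleteSpace H] {φ : ℕ → H} {lam : ℕ → ℝ} (hφ : Orthonormal ℝ φ)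
    (hlam : ∀ k, 0 < lam k) (hmono : Monotone lam) {q N : ℕ}
    (hq : q = 0 ∨ q = 1) {tt : ℕ → ℝ} (htt : ∀ n < N, tt n < tt (n + 1))
    {f : ℝ → H} (hf : IntervalIntegrable f volume (tt 0) (tt N)) {u1 u2 : ℝ → H}
    (hu1 : ContinuousOn u1 (Set.Icc (tt 0) (tt N))) (hu2 : ContinuousOn u2 (Set.Icc (tt 0) (tt N)))
    (hmem1 : ∀ t, MemHs φ lam 2 (u1 t))
    (hode1 : ∀ t ∈ Set.Ioo (tt 0) (tt N), HasDerivAt u1 (u2 t) t)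
    (hode2 : ∀ t ∈ Set.Ioo (tt 0) (tt N), HasDerivAt u2 (f t - Aop φ lam (u1 t)) t)
    (hder1 : ∀ m < q + 1, ∀ t ∈ Set.Ioo (tt 0) (tt N),
      HasDerivAt (iteratedDeriv m u1) (iteratedDeriv (m + 1) u1 t) t)
    (hder2 : ∀ m < q + 1, ∀ t ∈ Set.Ioo (tt 0) (tt N),
      HasDerivAt (iteratedDeriv m u2) (iteratedDeriv (m + 1) u2 t) t)
    (hreg1 : ∀ t, MemHs φ lam 2 (iteratedDeriv (q + 1) u1 t))
    (hreg2 : ∀ t, MemHs φ lam 1 (iteratedDeriv (q + 1) u2 t))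
    {c1 c2 : ℕ → ℕ → H}
    (hdG : ∀ d1 d2 : ℕ → ℕ → H, (∀ n j, MemHs φ lam 1 (d1 n j)) →
      (∀ n j, MemHs φ lam 1 (d2 n j)) →
      Bform φ lam tt N q c1 c2 d1 d2 =
        (∑ n ∈ Finset.Icc 1 N, ∫ s in tt (n-1)..tt n, ⟪f s, pval q d2 n s⟫)
          + aForm φ lam (u1 (tt 0)) (pval q d1 1 (tt 0)) + ⟪u2 (tt 0), pval q d2 1 (tt 0)⟫)
    {κ A₁ A₂ : ℝ} {D₁ D₂ : ℕ → ℝ} (hκ : ∀ n < N, tt (n + 1) - tt n ≤ κ)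
    (hA₁ : ∀ t ∈ Set.Ioo (tt 0) (tt N), hsNorm φ lam 1 (iteratedDeriv (q + 1) u1 t) ≤ A₁)
    (hA₂ : ∀ t ∈ Set.Ioo (tt 0) (tt N), ‖iteratedDeriv (q + 1) u2 t‖ ≤ A₂)
    (hD₁ : ∀ n < N, ∀ t ∈ Set.Ioo (tt n) (tt (n + 1)),
      hsNorm φ lam 2 (iteratedDeriv (q + 1) u1 t) ≤ D₁ n)
    (hD₂ : ∀ n < N, ∀ t ∈ Set.Ioo (tt n) (tt (n + 1)),
      hsNorm φ lam 1 (iteratedDeriv (q + 1) u2 t) ≤ D₂ n)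
    (K : ℕ) {n : ℕ} (hn : n < N) {s : ℝ} (hs : s ∈ Set.Icc (tt n) (tt (n + 1))) :
    ‖energyModes φ lam K (pval q c1 (n + 1) s - u1 s)
        + velocityModes φ K (pval q c2 (n + 1) s - u2 s)‖
      ≤ 48 * (∑ i ∈ Finset.range N, (tt (i + 1) - tt i) ^ (q + 2) * (D₁ i + D₂ i))
        + 6 * κ ^ (q + 1) * (A₁ + A₂) := by
  have hmon := monotoneOn_mesh htt
  let J : H → H → EuclideanSpace ℝ (Fin K ⊕ Fin K) :=
    fun x y => energyModes φ lam K x + velocityModes φ K y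
  have hJadd : ∀ x y x' y', J (x + x') (y + y') = J x y + J x' y' := fun x y x' y' => by
    simp only [J, map_add]
    abel
  have hJsub : ∀ x y x' y', J (x - x') (y - y') = J x y - J x' y' := fun x y x' y' => by
    simp only [J, map_sub]
    abel
  have hJsmul : ∀ (r : ℝ) x y, J (r • x) (r • y) = r • J x y := fun r x y => by
    simp only [J, map_smul, smul_add]
  have hJd : ∀ {x y : ℝ → H} {x' y' : H} {t : ℝ}, HasDerivAt x x' t → HasDerivAt y y' t →
      HasDerivAt (fun r => J (x r) (y r)) (J x' y') t := fun hx hy =>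
    ((energyModes φ lam K).hasFDerivAt.comp_hasDerivAt _ hx).add
      ((velocityModes φ K).hasFDerivAt.comp_hasDerivAt _ hy)
  have h := dG_error_of_skew (waveGenerator lam K) (inner_waveGenerator_self lam K) hq htt
    (zd := fun m t => J (iteratedDeriv m u1 t) (iteratedDeriv m u2 t))
    (g := fun t => velocityModes φ K (f t))
    (P0 := fun n => J (c1 (n + 1) 0) (c2 (n + 1) 0))
    (P1 := fun n => J (pderiv q c1 (n + 1) 0) (pderiv q c2 (n + 1) 0))
    (Zm := fun n => J (leftLimit q tt c1 (u1 (tt 0)) n) (leftLimit q tt c2 (u2 (tt 0)) n))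
    (κ := κ) (M0 := A₁ + A₂) (M1 := fun i => D₁ i + D₂ i)
    (by
      simp only [iteratedDeriv_zero]
      exact ((energyModes φ lam K).continuous.comp_continuousOn hu1).add
        ((velocityModes φ K).continuous.comp_continuousOn hu2))
    (fun m hm t ht => hJd (hder1 m hm t ht) (hder2 m hm t ht))
    (fun t ht => by
      simp only [iteratedDeriv_zero]
      exact (hJd (hode1 t ht) (hode2 t ht)).congr_deriv (modes_ode hφ hlam K _ _ (hmem1 t)))
    ((velocityModes φ K).comp_intervalIntegrable hf)
    (fun h0 n _ => by
      subst h0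
      simp [pderiv, J])
    (by simp only [iteratedDeriv_zero, leftLimit])
    (fun n _ => by
      simp only [leftLimit, pval_eq_affine hq, hJadd, hJsmul])
    (fun n hn j hj => dG_modes_equation hφ hlam hq hdG hn hj
      (hf.mono_set (by
        rw [Set.uIcc_of_le (hmon hn.le hn n.le_succ),
          Set.uIcc_of_le (hmon N.zero_le Set.self_mem_Iic N.zero_le)]
        exact Set.Icc_subset_Icc (hmon N.zero_le hn.le n.zero_le) (hmon hn Set.self_mem_Iic hn)))
      K rfl)
    hκ
    (fun t ht => (norm_add_le _ _).trans (add_le_add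
      ((norm_energyModes_le hlam K (MemHs.one_of_two hlam hmono (hreg1 t))).trans (hA₁ t ht))
      ((norm_velocityModes_le hφ K _).trans (hA₂ t ht))))
    (fun n hn t ht => by
      simp only [J, map_add]
      exact (norm_add_le _ _).trans (add_le_add
        ((norm_waveGenerator_energyModes_le hlam K (hreg1 t)).trans (hD₁ n hn t ht))
        ((norm_waveGenerator_velocityModes_le hlam K (hreg2 t)).trans (hD₂ n hn t ht))))
    n hn s hs
  simp only [iteratedDeriv_zero, ← hJsmul, ← hJadd, ← hJsub, ← pval_eq_affine hq] at h
  exact h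

/-- A vector pair whose finite mode truncations are all bounded by `R` has energy and velocity
norms bounded by `R`. -/
theorem hsNorm_norm_le_of_modes_le {H : Type*} [NormedAddCommGroup H] [InnerProductSpace ℝ H]
    [CompleteSpace H] {φ : ℕ → H} {lam : ℕ → ℝ} (hφ : Orthonormal ℝ φ)
    (hφtotal : (Submodule.span ℝ (Set.range φ)).topologicalClosure = ⊤)
    (hlam : ∀ k, 0 < lam k) {x y : H} {R : ℝ}
    (h : ∀ K, ‖energyModes φ lam K x + velocityModes φ K y‖ ≤ R) :
    hsNorm φ lam 1 x ≤ R ∧ ‖y‖ ≤ R := by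
  have hR : 0 ≤ R := (norm_nonneg _).trans (h 0)
  have hsum : ∀ K, ∑ k ∈ Finset.range K, lam k * ⟪x, φ k⟫ ^ 2
      + ∑ k ∈ Finset.range K, ⟪y, φ k⟫ ^ 2 ≤ R ^ 2 := fun K => by
    refine le_trans (le_of_eq ?_) (pow_le_pow_left₀ (norm_nonneg _) (h K) 2)
    rw [EuclideanSpace.real_norm_sq_eq, Fintype.sum_sum_type,
      ← Fin.sum_univ_eq_sum_range (fun k => lam k * ⟪x, φ k⟫ ^ 2),
      ← Fin.sum_univ_eq_sum_range (fun k => ⟪y, φ k⟫ ^ 2)]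
    simp only [PiLp.add_apply, energyModes_inl, velocityModes_inl, energyModes_inr,
      velocityModes_inr, add_zero, zero_add, mul_pow, Real.sq_sqrt (hlam _).le,
      real_inner_comm (φ _)]
  refine ⟨hsNorm_one_le_of_sum_le hlam hR fun K => ?_,
    norm_le_of_sum_inner_sq_le hφ hφtotal hR fun K => ?_⟩
  · have h2 : 0 ≤ ∑ k ∈ Finset.range K, ⟪y, φ k⟫ ^ 2 := Finset.sum_nonneg fun _ _ => sq_nonneg _
    linarith [hsum K]
  · have h2 : 0 ≤ ∑ k ∈ Finset.range K, lam k * ⟪x, φ k⟫ ^ 2 :=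
      Finset.sum_nonneg fun k _ => mul_nonneg (hlam k).le (sq_nonneg _)
    linarith [hsum K]

/-- Every point of `(tt 0, tt N]` lies in one of the half-open mesh intervals. -/
theorem exists_mem_Ioc_mesh {tt : ℕ → ℝ} {N : ℕ} {t : ℝ} (ht : t ∈ Set.Ioc (tt 0) (tt N)) :
    ∃ n < N, t ∈ Set.Ioc (tt n) (tt (n + 1)) := by
  induction N with
  | zero => exact absurd (ht.1.trans_le ht.2) (lt_irrefl _)
  | succ N ih =>
    rcases le_or_gt t (tt N) with h | h
    · obtain ⟨n, hn, h⟩ := ih ⟨ht.1, h⟩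
      exact ⟨n, hn.trans N.lt_succ_self, h⟩
    · exact ⟨N, N.lt_succ_self, h, ht.2⟩

/-- **Theorem 4.2, first estimate (uniform-in-time error of dG(0)/dG(1), energy norm).**
`‖e₁‖_{1,I_N} + ‖e₂‖_{I_N} ≤ C (k^{q+1}‖u₁^{(q+1)}‖_{1,I_N} + k^{q+1}‖u₂^{(q+1)}‖_{I_N}
  + Σₙ kₙ^{q+2}‖u₂^{(q+1)}‖_{1,Iₙ} + Σₙ kₙ^{q+2}‖u₁^{(q+1)}‖_{2,Iₙ})`. -/
theorem dG_uniform_error_energy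
    {H : Type*} [NormedAddCommGroup H] [InnerProductSpace ℝ H] [CompleteSpace H]
    (φ : ℕ → H) (lam : ℕ → ℝ)
    (hφ : Orthonormal ℝ φ)
    (hφtotal : (Submodule.span ℝ (Set.range φ)).topologicalClosure = ⊤)
    (hlam_pos : ∀ k, 0 < lam k) (hlam_mono : Monotone lam)
    (hlam_top : Filter.Tendsto lam Filter.atTop Filter.atTop)
    (q : ℕ) (hq : q = 0 ∨ q = 1) :
    ∃ C : ℝ, 0 < C ∧
      ∀ (T : ℝ), 0 < T → ∀ (N : ℕ), ∀ hN : 1 ≤ N,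
      ∀ tt : ℕ → ℝ, tt 0 = 0 → tt N = T → (∀ n < N, tt n < tt (n + 1)) →
      -- data
      ∀ f : ℝ → H, IntervalIntegrable f volume 0 T →
      ∀ u0 v0 : H, MemHs φ lam 1 u0 →
      -- exact solution (u₁,u₂)
      ∀ u1 u2 : ℝ → H,
      u1 0 = u0 → u2 0 = v0 →
      ContinuousOn u1 (Set.Icc 0 T) → ContinuousOn u2 (Set.Icc 0 T) →
      (∀ t, MemHs φ lam 2 (u1 t)) → (∀ t, MemHs φ lam 1 (u2 t)) →
      (∀ t ∈ Set.Ioo 0 T, HasDerivAt u1 (u2 t) t) →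
      (∀ t ∈ Set.Ioo 0 T, HasDerivAt u2 (f t - Aop φ lam (u1 t)) t) →
      -- temporal regularity of the exact solution
      (∀ m < q + 1, ∀ t ∈ Set.Ioo 0 T,
        HasDerivAt (iteratedDeriv m u1) (iteratedDeriv (m+1) u1 t) t) →
      (∀ m < q + 1, ∀ t ∈ Set.Ioo 0 T,
        HasDerivAt (iteratedDeriv m u2) (iteratedDeriv (m+1) u2 t) t) →
      (∀ t, MemHs φ lam 2 (iteratedDeriv (q+1) u1 t)) →
      (∀ t, MemHs φ lam 1 (iteratedDeriv (q+1) u2 t)) →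
      -- finiteness of the right-hand side
      BddAbove ((fun t => hsNorm φ lam 1 (iteratedDeriv (q+1) u1 t)) '' Set.Ioo 0 T) →
      BddAbove ((fun t => ‖iteratedDeriv (q+1) u2 t‖) '' Set.Ioo 0 T) →
      BddAbove ((fun t => hsNorm φ lam 1 (iteratedDeriv (q+1) u2 t)) '' Set.Ioo 0 T) →
      BddAbove ((fun t => hsNorm φ lam 2 (iteratedDeriv (q+1) u1 t)) '' Set.Ioo 0 T) →
      -- the dG(q) approximation U = (U₁,U₂) ∈ 𝒱_q (coefficient families c1, c2)
      ∀ c1 c2 : ℕ → ℕ → H,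
      (∀ n j, MemHs φ lam 1 (c1 n j)) → (∀ n j, MemHs φ lam 1 (c2 n j)) →
      (∀ d1 d2 : ℕ → ℕ → H, (∀ n j, MemHs φ lam 1 (d1 n j)) →
        (∀ n j, MemHs φ lam 1 (d2 n j)) →
        Bform φ lam tt N q c1 c2 d1 d2 =
          (∑ n ∈ Finset.Icc 1 N, ∫ s in tt (n-1)..tt n, ⟪f s, pval q d2 n s⟫)
            + aForm φ lam u0 (pval q d1 1 (tt 0)) + ⟪v0, pval q d2 1 (tt 0)⟫) →
      -- U₁, U₂ as functions of time (left-continuous piecewise polynomials)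
      ∀ U1f U2f : ℝ → H,
      (∀ n ∈ Finset.Icc 1 N, ∀ t ∈ Set.Ioc (tt (n-1)) (tt n), U1f t = pval q c1 n t) →
      (∀ n ∈ Finset.Icc 1 N, ∀ t ∈ Set.Ioc (tt (n-1)) (tt n), U2f t = pval q c2 n t) →
      (BddAbove ((fun t => hsNorm φ lam 1 (U1f t - u1 t)) '' Set.Ioo 0 T) ∧
       BddAbove ((fun t => ‖U2f t - u2 t‖) '' Set.Ioo 0 T) ∧
       supIoo (fun t => hsNorm φ lam 1 (U1f t - u1 t)) 0 T
          + supIoo (fun t => ‖U2f t - u2 t‖) 0 T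
        ≤ C * (((Finset.Icc 1 N).sup' (Finset.nonempty_Icc.mpr hN)
                  (fun n => tt n - tt (n-1))) ^ (q+1) *
                supIoo (fun t => hsNorm φ lam 1 (iteratedDeriv (q+1) u1 t)) 0 T
            + ((Finset.Icc 1 N).sup' (Finset.nonempty_Icc.mpr hN)
                  (fun n => tt n - tt (n-1))) ^ (q+1) *
                supIoo (fun t => ‖iteratedDeriv (q+1) u2 t‖) 0 T
            + (∑ n ∈ Finset.Icc 1 N, (tt n - tt (n-1)) ^ (q+2) *
                supIoo (fun t => hsNorm φ lam 1 (iteratedDeriv (q+1) u2 t))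
                  (tt (n-1)) (tt n))
            + (∑ n ∈ Finset.Icc 1 N, (tt n - tt (n-1)) ^ (q+2) *
                supIoo (fun t => hsNorm φ lam 2 (iteratedDeriv (q+1) u1 t))
                  (tt (n-1)) (tt n)))) := by
  refine ⟨96, by norm_num, ?_⟩
  intro T hT N hN tt htt0 httN htt f hf u0 v0 _ u1 u2 hi1 hi2 hu1 hu2 hmem1 _ hode1 hode2
    hder1 hder2 hreg1 hreg2 hb1 hb2 hb3 hb4 c1 c2 _ _ hdG U1f U2f hU1 hU2
  subst httN hi1 hi2
  have hmon := monotoneOn_mesh htt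
  set κ := (Finset.Icc 1 N).sup' (Finset.nonempty_Icc.mpr hN) (fun n => tt n - tt (n - 1)) with hκ
  have hκle : ∀ n < N, tt (n + 1) - tt n ≤ κ := fun n hn =>
    Finset.le_sup' (fun n => tt n - tt (n - 1)) (Finset.mem_Icc.2 ⟨n.succ_pos, hn⟩)
  have hκ0 : 0 ≤ κ := (sub_nonneg.2 (htt 0 hN).le).trans (hκle 0 hN)
  have hsub : ∀ n < N, Set.Ioo (tt n) (tt (n + 1)) ⊆ Set.Ioo 0 (tt N) := fun n hn => by
    rw [← htt0]
    exact Set.Ioo_subset_Ioo (hmon N.zero_le hn.le n.zero_le) (hmon hn Set.self_mem_Iic hn)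
  have hsup : ∀ {g : ℝ → ℝ} {a b : ℝ}, BddAbove (g '' Set.Ioo a b) →
      ∀ t ∈ Set.Ioo a b, g t ≤ supIoo g a b := fun h t ht =>
    le_csSup h (Set.mem_image_of_mem _ ht)
  have hsup0 : ∀ {g : ℝ → ℝ} {a b : ℝ}, (∀ t, 0 ≤ g t) → 0 ≤ supIoo g a b := fun h =>
    Real.sSup_nonneg (by rintro _ ⟨t, _, rfl⟩; exact h t)
  set A₁ := supIoo (fun t => hsNorm φ lam 1 (iteratedDeriv (q+1) u1 t)) 0 (tt N)
  set A₂ := supIoo (fun t => ‖iteratedDeriv (q+1) u2 t‖) 0 (tt N)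
  have hA₁ : 0 ≤ A₁ := hsup0 fun _ => Real.sqrt_nonneg _
  have hA₂ : 0 ≤ A₂ := hsup0 fun _ => norm_nonneg _
  have hsum : ∀ D : ℕ → ℕ → ℝ, ∑ n ∈ Finset.Icc 1 N, (tt n - tt (n - 1)) ^ (q + 2) * D (n - 1) n
      = ∑ n ∈ Finset.range N, (tt (n + 1) - tt n) ^ (q + 2) * D n (n + 1) := fun D => by
    rw [Finset.range_eq_Ico]
    exact (Finset.sum_Ico_add' (fun n => (tt n - tt (n - 1)) ^ (q + 2) * D (n - 1) n) 0 N 1).symm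
  set S₂ := fun n m => supIoo (fun t => hsNorm φ lam 1 (iteratedDeriv (q+1) u2 t)) (tt n) (tt m)
    with hS₂
  set S₁ := fun n m => supIoo (fun t => hsNorm φ lam 2 (iteratedDeriv (q+1) u1 t)) (tt n) (tt m)
    with hS₁
  set R := 48 * (∑ i ∈ Finset.range N, (tt (i + 1) - tt i) ^ (q + 2)
    * (S₁ i (i + 1) + S₂ i (i + 1))) + 6 * κ ^ (q + 1) * (A₁ + A₂) with hR
  have key : ∀ t ∈ Set.Ioo 0 (tt N),
      hsNorm φ lam 1 (U1f t - u1 t) ≤ R ∧ ‖U2f t - u2 t‖ ≤ R := fun t ht => by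
    obtain ⟨n, hn, htn⟩ := exists_mem_Ioc_mesh (tt := tt) (N := N) (t := t)
      ⟨htt0.symm ▸ ht.1, ht.2.le⟩
    rw [hU1 (n + 1) (Finset.mem_Icc.2 ⟨n.succ_pos, hn⟩) t htn,
      hU2 (n + 1) (Finset.mem_Icc.2 ⟨n.succ_pos, hn⟩) t htn]
    refine hsNorm_norm_le_of_modes_le hφ hφtotal hlam_pos fun K => ?_
    rw [← htt0] at hf hu1 hu2 hode1 hode2 hder1 hder2 hdG
    exact dG_modes_error hφ hlam_pos hlam_mono hq htt hf hu1 hu2 hmem1 hode1 hode2 hder1 hder2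
      hreg1 hreg2 hdG hκle (htt0.symm ▸ hsup hb1) (htt0.symm ▸ hsup hb2)
      (fun n hn => hsup (hb4.mono (Set.image_mono (hsub n hn))))
      (fun n hn => hsup (hb3.mono (Set.image_mono (hsub n hn)))) K hn ⟨htn.1.le, htn.2⟩
  have hne : (Set.Ioo 0 (tt N)).Nonempty := Set.nonempty_Ioo.2 hT
  refine ⟨⟨R, ?_⟩, ⟨R, ?_⟩, ?_⟩
  · rintro _ ⟨t, ht, rfl⟩
    exact (key t ht).1
  · rintro _ ⟨t, ht, rfl⟩
    exact (key t ht).2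
  have h1 : supIoo (fun t => hsNorm φ lam 1 (U1f t - u1 t)) 0 (tt N) ≤ R :=
    csSup_le (hne.image _) (by rintro _ ⟨t, ht, rfl⟩; exact (key t ht).1)
  have h2 : supIoo (fun t => ‖U2f t - u2 t‖) 0 (tt N) ≤ R :=
    csSup_le (hne.image _) (by rintro _ ⟨t, ht, rfl⟩; exact (key t ht).2)
  refine (add_le_add h1 h2).trans ?_
  rw [hsum S₁, hsum S₂, hR]
  simp only [mul_add, Finset.sum_add_distrib]
  have h3 : 0 ≤ κ ^ (q + 1) * A₁ := by positivity
  have h4 : 0 ≤ κ ^ (q + 1) * A₂ := by positivity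
  linarith
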